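/- arXiv:1003.3434 — 6 statements merged into one kernel-verified Lean document; each statement's English description precedes it below -/
import Mathlib

section
/- Let n ≥ 2. In the Lie algebra of all ℂ-derivations of the polynomial ring ℂ[x₁,…,xₙ] (with the commutator bracket), the Lie subalgebra generated by the set of all derivations of the form f·∂ᵢ and xᵢ·f·∂ᵢ, where 1 ≤ i ≤ n and f ∈ ℂ[x₁,…,xₙ] satisfies ∂ᵢf = 0, is the whole Lie algebra of derivations of ℂ[x₁,…,xₙ]. -/
open MvPolynomial

namespace MvPolynomial

variable {R σ : Type*} [CommRing R]

theorem lie_smul_pderiv (i j : σ) (f g : MvPolynomial σ R) :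
    ⁅(f • pderiv i : Derivation R (MvPolynomial σ R) (MvPolynomial σ R)),
      (g • pderiv j : Derivation R (MvPolynomial σ R) (MvPolynomial σ R))⁆ =
      (f * pderiv i g) • pderiv j - (g * pderiv j f) • pderiv i := by
  classical
  refine derivation_ext fun k => ?_
  have h (p q : σ) : pderiv p (pderiv q (X k : MvPolynomial σ R)) = 0 := by
    rw [pderiv_X]
    by_cases hk : k = q
    · subst hk; simp
    · simp [Pi.single_eq_of_ne hk]
  simp only [Derivation.commutator_apply, Derivation.smul_apply, Derivation.sub_apply,
    smul_eq_mul, Derivation.leibniz, h]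
  ring

theorem derivation_eq_sum_smul_pderiv [Fintype σ]
    (D : Derivation R (MvPolynomial σ R) (MvPolynomial σ R)) :
    D = ∑ i, D (X i) • pderiv i := by
  classical
  refine derivation_ext fun k => ?_
  rw [← Derivation.coeFnAddMonoidHom_apply (∑ i, D (X i) • pderiv i), map_sum, Finset.sum_apply]
  simp [pderiv_X, Pi.single_apply]

theorem smul_pderiv_mem_of_shears_overshears {K : Type*} [Field K] [CharZero K]
    {L : LieSubalgebra K (Derivation K (MvPolynomial σ K) (MvPolynomial σ K))}
    (hs : ∀ (i : σ) (f : MvPolynomial σ K), pderiv i f = 0 → f • pderiv i ∈ L)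
    (ho : ∀ (i : σ) (f : MvPolynomial σ K), pderiv i f = 0 → (X i * f) • pderiv i ∈ L)
    {i j : σ} (hij : i ≠ j) {c : MvPolynomial σ K} (hi : pderiv i c = 0) (hj : pderiv j c = 0)
    (a b : ℕ) : (X i ^ a * X j ^ b * c) • pderiv i ∈ L := by
  have hXj : pderiv i (X j : MvPolynomial σ K) = 0 := pderiv_X_of_ne hij.symm
  have hXi : pderiv j (X i : MvPolynomial σ K) = 0 := pderiv_X_of_ne hij
  cases a with
  | zero => exact hs i _ (by simp [hXj, hi])
  | succ a =>
    have h₁ := L.lie_mem (ho i (X j ^ (b + 1) * c) (by simp [hXj, hi]))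
      (hs j (X i ^ a) (by simp [hXi]))
    have h₂ := L.lie_mem (hs i (X j ^ b * c) (by simp [hXj, hi]))
      (ho j (X i ^ (a + 1)) (by simp [hXi]))
    rw [lie_smul_pderiv] at h₁ h₂
    have h := L.sub_mem (L.smul_mem (a : K) h₂) (L.smul_mem (a + 1 : K) h₁)
    have hne : (a + b + 1 : K) ≠ 0 := by exact_mod_cast (a + b).succ_ne_zero
    refine (Submodule.smul_mem_iff L.toSubmodule hne).1 ?_
    rw [LieSubalgebra.mem_toSubmodule]
    convert h using 1
    ext k : 1
    simp only [Derivation.smul_apply, Derivation.sub_apply, smul_eq_mul, Derivation.leibniz,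
      pderiv_pow, hXi, hXj, hj, pderiv_X_self, smul_eq_C_mul, map_add, map_natCast, map_one]
    rcases a with _ | a <;> rcases b with _ | b <;> push_cast <;> simp <;> ring

theorem monomial_smul_pderiv_mem_of_shears_overshears {K : Type*} [Field K] [CharZero K]
    {L : LieSubalgebra K (Derivation K (MvPolynomial σ K) (MvPolynomial σ K))}
    (hs : ∀ (i : σ) (f : MvPolynomial σ K), pderiv i f = 0 → f • pderiv i ∈ L)
    (ho : ∀ (i : σ) (f : MvPolynomial σ K), pderiv i f = 0 → (X i * f) • pderiv i ∈ L)
    {i j : σ} (hij : i ≠ j) (m : σ →₀ ℕ) (r : K) : monomial m r • pderiv i ∈ L := by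
  have hm : monomial m r =
      X i ^ m i * X j ^ m j * monomial ((m.erase i).erase j) r := by
    rw [X_pow_eq_monomial, X_pow_eq_monomial, monomial_mul, monomial_mul, one_mul, one_mul]
    congr 1
    conv_lhs => rw [← Finsupp.single_add_erase i m, ← Finsupp.single_add_erase j (m.erase i),
      Finsupp.erase_ne hij.symm, ← add_assoc]
  rw [hm]
  exact smul_pderiv_mem_of_shears_overshears hs ho hij
    (by simp [pderiv_monomial, Finsupp.erase_ne hij]) (by simp [pderiv_monomial]) _ _

end MvPolynomial

/-- The algebraic density property of ℂⁿ (Andersén–Lempert): for `n ≥ 2`, the Lie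
subalgebra of derivations of `ℂ[x₁,…,xₙ]` generated by the shear and overshear fields
`f·∂ᵢ` and `xᵢ·f·∂ᵢ` with `∂ᵢ f = 0` is the whole Lie algebra of derivations. -/
theorem algebraic_density_property_Cn (n : ℕ) (hn : 2 ≤ n) :
    LieSubalgebra.lieSpan ℂ
      (Derivation ℂ (MvPolynomial (Fin n) ℂ) (MvPolynomial (Fin n) ℂ))
      { D | ∃ (i : Fin n) (f : MvPolynomial (Fin n) ℂ), pderiv i f = 0 ∧
          (D = f • pderiv i ∨ D = (X i * f) • pderiv i) } = ⊤ := by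
  rw [eq_top_iff]
  intro D _
  rw [derivation_eq_sum_smul_pderiv D]
  refine sum_mem fun i _ => ?_
  have : Nontrivial (Fin n) := Fin.nontrivial_iff_two_le.2 hn
  obtain ⟨j, hj⟩ := exists_ne i
  induction D (X i) using MvPolynomial.induction_on' with
  | monomial m r =>
    exact monomial_smul_pderiv_mem_of_shears_overshears
      (fun i f hf => LieSubalgebra.subset_lieSpan (by exact ⟨i, f, hf, Or.inl rfl⟩))
      (fun i f hf => LieSubalgebra.subset_lieSpan (by exact ⟨i, f, hf, Or.inr rfl⟩)) hj.symm m r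
  | add p q hp hq =>
    rw [add_smul]
    exact add_mem hp hq
end

section
/- Let R = ℂ[a₁,a₂,b₁,b₂]/(a₁b₂ − a₂b₁ − 1) be the coordinate ring of SL₂ and let D be any ℂ-derivation of R satisfying D(a₁) = D(a₂) = 0, D(b₁) = a₁, D(b₂) = a₂. Then the kernel of D equals the ℂ-subalgebra of R generated by a₁ and a₂; that is, Ker D = ℂ[a₁,a₂]. -/
open MvPolynomial

/-- The coordinate ring `ℂ[SL₂] = ℂ[a₁,a₂,b₁,b₂]/(a₁b₂ − a₂b₁ − 1)`, with
`a₁ = X 0`, `a₂ = X 1`, `b₁ = X 2`, `b₂ = X 3`. -/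
noncomputable abbrev SL2Coord : Type :=
  MvPolynomial (Fin 4) ℂ ⧸
    Ideal.span {(X 0 * X 3 - X 1 * X 2 - 1 : MvPolynomial (Fin 4) ℂ)}

noncomputable abbrev SL2Coord.mk : MvPolynomial (Fin 4) ℂ →+* SL2Coord :=
  Ideal.Quotient.mk _

namespace SL2Coord

theorem mk_relation : mk (X 0) * mk (X 3) = mk (X 1) * mk (X 2) + 1 := by
  rw [← map_mul, ← map_mul, ← map_one mk, ← map_add, Ideal.Quotient.eq,
    Ideal.mem_span_singleton]
  exact dvd_of_eq (by ring)

theorem exists_algHom {K : Type*} [CommRing K] [Algebra ℂ K] (v : Fin 4 → K)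
    (hv : v 0 * v 3 - v 1 * v 2 - 1 = 0) :
    ∃ φ : SL2Coord →ₐ[ℂ] K, ∀ i, φ (mk (X i)) = v i := by
  refine ⟨Ideal.Quotient.liftₐ _ (aeval v) ?_, fun i => ?_⟩
  · intro a ha
    obtain ⟨c, rfl⟩ := Ideal.mem_span_singleton.1 ha
    simp [hv]
  · exact aeval_X v i

theorem eq_zero_of_mk_X_zero_mul {f : SL2Coord} (hf : mk (X 0) * f = 0) : f = 0 := by
  obtain ⟨g, rfl⟩ := Ideal.Quotient.mk_surjective f
  rw [← map_mul, Ideal.Quotient.eq_zero_iff_mem, Ideal.mem_span_singleton] at hf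
  rw [Ideal.Quotient.eq_zero_iff_mem, Ideal.mem_span_singleton]
  obtain ⟨c, hc⟩ := hf
  have hX : Prime (X 0 : MvPolynomial (Fin 4) ℂ) := X_prime
  rcases hX.dvd_or_dvd (Dvd.intro _ hc) with ⟨d, hd⟩ | ⟨d, rfl⟩
  · have := congrArg (eval (0 : Fin 4 → ℂ)) hd
    simp at this
  · exact ⟨d, mul_left_cancel₀ hX.ne_zero (by rw [hc]; ring)⟩

/-- The map `ℂ[y][x] → ℂ[SL₂]` sending `x` to `a₁` and `y` to `a₂`. -/
noncomputable def ofA : Polynomial (Polynomial ℂ) →+* SL2Coord :=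
  Polynomial.eval₂RingHom
    (Polynomial.eval₂RingHom (algebraMap ℂ SL2Coord) (mk (X 1))) (mk (X 0))

/-- The map `ℂ[y][x][z] → ℂ[SL₂]` sending `x`, `y`, `z` to `a₁`, `a₂`, `b₁`. -/
noncomputable def ofAB : Polynomial (Polynomial (Polynomial ℂ)) →+* SL2Coord :=
  Polynomial.eval₂RingHom ofA (mk (X 2))

@[simp] theorem ofA_X : ofA Polynomial.X = mk (X 0) := by simp [ofA]

@[simp] theorem ofA_C_X : ofA (Polynomial.C Polynomial.X) = mk (X 1) := by simp [ofA]

@[simp] theorem ofA_C_C (c : ℂ) :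
    ofA (Polynomial.C (Polynomial.C c)) = algebraMap ℂ SL2Coord c := by simp [ofA]

@[simp] theorem ofAB_X : ofAB Polynomial.X = mk (X 2) := by simp [ofAB]

@[simp] theorem ofAB_C (p : Polynomial (Polynomial ℂ)) : ofAB (Polynomial.C p) = ofA p := by
  simp [ofAB]

theorem ofA_mem_adjoin (p : Polynomial (Polynomial ℂ)) :
    ofA p ∈ Algebra.adjoin ℂ ({mk (X 0), mk (X 1)} : Set SL2Coord) := by
  have hx : mk (X 0) ∈ Algebra.adjoin ℂ ({mk (X 0), mk (X 1)} : Set SL2Coord) :=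
    Algebra.subset_adjoin (by simp)
  have hy : mk (X 1) ∈ Algebra.adjoin ℂ ({mk (X 0), mk (X 1)} : Set SL2Coord) :=
    Algebra.subset_adjoin (by simp)
  rw [ofA, Polynomial.coe_eval₂RingHom, Polynomial.eval₂_eq_sum_range]
  refine sum_mem fun i _ => mul_mem ?_ (pow_mem hx i)
  rw [Polynomial.coe_eval₂RingHom, Polynomial.eval₂_eq_sum_range]
  exact sum_mem fun j _ => mul_mem (Subalgebra.algebraMap_mem _ _) (pow_mem hy j)

theorem exists_field_embedding (A : Type) [CommRing A] [IsDomain A] [Algebra ℂ A] :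
    ∃ (K : Type) (_ : Field K) (_ : Algebra ℂ K) (t : A →+* K), Function.Injective t ∧
      ∀ c, t (algebraMap ℂ A c) = algebraMap ℂ K c :=
  ⟨FractionRing A, inferInstance, inferInstance, algebraMap A _, IsFractionRing.injective A _,
    fun c => (IsScalarTower.algebraMap_apply ℂ A (FractionRing A) c).symm⟩

theorem ofAB_injective : Function.Injective ofAB := by
  obtain ⟨K, _, _, t, ht, hc⟩ :=
    exists_field_embedding (Polynomial (Polynomial (Polynomial ℂ)))
  let x : K := t (Polynomial.C Polynomial.X)
  let y : K := t (Polynomial.C (Polynomial.C Polynomial.X))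
  let z : K := t Polynomial.X
  have hx : x ≠ 0 := by
    simp [x, map_eq_zero_iff t ht]
  obtain ⟨φ, hφ⟩ := exists_algHom ![x, y, z, (y * z + 1) / x] (by
    simp
    field_simp
    ring)
  have hcomp : (φ : SL2Coord →+* K).comp ofAB = t := by
    ext
    · simp only [RingHom.comp_apply, ofAB_C, ofA_C_C]
      exact (φ.commutes _).trans (hc _).symm
    · simpa using hφ 1
    · simpa using hφ 0
    · simpa using hφ 2
  have : Function.Injective ((φ : SL2Coord →+* K).comp ofAB) := hcomp ▸ ht
  exact Function.Injective.of_comp this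

theorem coeff_zero_eq_zero_of_ofA {p : Polynomial (Polynomial ℂ)} {f : SL2Coord}
    (h : mk (X 0) * f = ofA p) : p.coeff 0 = 0 := by
  obtain ⟨K, _, _, t, ht, hc⟩ := exists_field_embedding (Polynomial ℂ)
  have hy : t Polynomial.X ≠ 0 := by
    simp [map_eq_zero_iff t ht]
  obtain ⟨φ, hφ⟩ := exists_algHom ![0, t Polynomial.X, -1 / t Polynomial.X, 0] (by
    simp [mul_div_cancel₀, hy])
  have hcomp : (φ : SL2Coord →+* K).comp ofA = t.comp Polynomial.constantCoeff := by
    ext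
    · simp only [RingHom.comp_apply, ofA_C_C, Polynomial.constantCoeff_apply,
        Polynomial.coeff_C_zero]
      exact (φ.commutes _).trans (hc _).symm
    · simpa using hφ 1
    · simpa using hφ 0
  apply ht
  have h' : φ (ofA p) = t (p.coeff 0) := RingHom.congr_fun hcomp p
  rw [← h', ← h, map_mul, hφ 0]
  simp

theorem mem_range_ofA_of_pow_mul (n : ℕ) {f : SL2Coord} :
    ∀ {p : Polynomial (Polynomial ℂ)}, mk (X 0) ^ n * f = ofA p → f ∈ ofA.range := by
  induction n with
  | zero => exact fun {p} h => ⟨p, by simpa using h.symm⟩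
  | succ n ih =>
    intro p h
    rw [pow_succ', mul_assoc] at h
    obtain ⟨q, rfl⟩ := Polynomial.X_dvd_iff.2 (coeff_zero_eq_zero_of_ofA h)
    refine ih (p := q) (sub_eq_zero.1 (eq_zero_of_mk_X_zero_mul ?_))
    rw [mul_sub, h, map_mul, ofA_X, sub_self]

theorem exists_pow_mul_eq_ofAB (f : SL2Coord) : ∃ n p, mk (X 0) ^ n * f = ofAB p := by
  obtain ⟨g, rfl⟩ := Ideal.Quotient.mk_surjective f
  induction g using MvPolynomial.induction_on with
  | C c => exact ⟨0, Polynomial.C (Polynomial.C (Polynomial.C c)), by simp; rfl⟩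
  | add g h hg hh =>
    obtain ⟨n, p, hp⟩ := hg
    obtain ⟨m, q, hq⟩ := hh
    refine ⟨n + m, Polynomial.C (Polynomial.X ^ m) * p + Polynomial.C (Polynomial.X ^ n) * q, ?_⟩
    simp only [map_add, map_mul, ofAB_C, map_pow, ofA_X, ← hp, ← hq]
    ring
  | mul_X g i hg =>
    obtain ⟨n, p, hp⟩ := hg
    have hX : ∃ q, mk (X 0) * mk (X i) = ofAB q := by
      fin_cases i
      · exact ⟨Polynomial.C (Polynomial.X * Polynomial.X), by simp⟩
      · exact ⟨Polynomial.C (Polynomial.X * Polynomial.C Polynomial.X), by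
          simp only [ofAB_C, map_mul, ofA_X, ofA_C_X]; rfl⟩
      · exact ⟨Polynomial.C Polynomial.X * Polynomial.X, by simp⟩
      · exact ⟨Polynomial.C (Polynomial.C Polynomial.X) * Polynomial.X + 1, by
          simpa using mk_relation⟩
    obtain ⟨q, hq⟩ := hX
    refine ⟨n + 1, p * q, ?_⟩
    rw [map_mul, map_mul, ← hp, ← hq]
    ring

section Derivation

variable (D : Derivation ℂ SL2Coord SL2Coord)

theorem derivation_eq_zero_of_mem_adjoin (h1 : D (mk (X 0)) = 0) (h2 : D (mk (X 1)) = 0)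
    {f : SL2Coord} (hf : f ∈ Algebra.adjoin ℂ ({mk (X 0), mk (X 1)} : Set SL2Coord)) :
    D f = 0 := by
  induction hf using Algebra.adjoin_induction with
  | mem x hx => rcases hx with rfl | rfl <;> assumption
  | algebraMap c => exact D.map_algebraMap c
  | add x y _ _ hx hy => rw [map_add, hx, hy, add_zero]
  | mul x y _ _ hx hy => rw [D.leibniz, hx, hy, smul_zero, smul_zero, add_zero]

theorem derivation_ofAB (h1 : D (mk (X 0)) = 0) (h2 : D (mk (X 1)) = 0)
    (h3 : D (mk (X 2)) = mk (X 0)) (p : Polynomial (Polynomial (Polynomial ℂ))) :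
    D (ofAB p) = ofAB (Polynomial.C Polynomial.X * Polynomial.derivative p) := by
  induction p using Polynomial.induction_on' with
  | add p q hp hq => rw [map_add, map_add, hp, hq, map_add, mul_add, map_add]
  | monomial n a =>
    have ha : D (ofA a) = 0 := derivation_eq_zero_of_mem_adjoin D h1 h2 (ofA_mem_adjoin a)
    simp only [← Polynomial.C_mul_X_pow_eq_monomial, Polynomial.derivative_C_mul_X_pow, map_mul,
      map_pow, map_natCast, ofAB_C, ofAB_X, ofA_X, D.leibniz, D.leibniz_pow, ha, h3,
      smul_eq_mul, nsmul_eq_mul]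
    ring

end Derivation

end SL2Coord

open SL2Coord in
/-- For any ℂ-derivation `D` of `ℂ[SL₂]` with `D a₁ = D a₂ = 0`, `D b₁ = a₁`,
`D b₂ = a₂`, the kernel of `D` is the ℂ-subalgebra generated by `a₁` and `a₂`:
`Ker D = ℂ[a₁,a₂]`. -/
theorem sl2_derivation_kernel (D : Derivation ℂ SL2Coord SL2Coord)
    (h1 : D (SL2Coord.mk (X 0)) = 0) (h2 : D (SL2Coord.mk (X 1)) = 0)
    (h3 : D (SL2Coord.mk (X 2)) = SL2Coord.mk (X 0))
    (h4 : D (SL2Coord.mk (X 3)) = SL2Coord.mk (X 1)) :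
    ∀ f : SL2Coord,
      D f = 0 ↔ f ∈ Algebra.adjoin ℂ ({SL2Coord.mk (X 0), SL2Coord.mk (X 1)} : Set SL2Coord) := by
  refine fun f => ⟨fun hf => ?_, derivation_eq_zero_of_mem_adjoin D h1 h2⟩
  obtain ⟨n, p, hp⟩ := exists_pow_mul_eq_ofAB f
  have hD : ofAB (Polynomial.C Polynomial.X * Polynomial.derivative p) = 0 := by
    rw [← derivation_ofAB D h1 h2 h3, ← hp, D.leibniz, D.leibniz_pow, hf, h1]
    simp
  have hp' : Polynomial.derivative p = 0 := by
    simpa using (map_eq_zero_iff ofAB ofAB_injective).1 hD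
  rw [Polynomial.eq_C_of_derivative_eq_zero hp', ofAB_C] at hp
  obtain ⟨q, rfl⟩ := mem_range_ofA_of_pow_mul n hp
  exact ofA_mem_adjoin q
end

section
/- Let R = ℂ[a₁,a₂,b₁,b₂]/(a₁b₂ − a₂b₁ − 1) be the coordinate ring of SL₂. Then R is spanned as a ℂ-vector space by products f·g where f lies in the ℂ-subalgebra generated by a₁,a₂ and g lies in the ℂ-subalgebra generated by b₁,b₂; that is, Span(ℂ[a₁,a₂]·ℂ[b₁,b₂]) = R. -/
open MvPolynomial

/-- Semi-compatibility for `ℂ[SL₂]`: the coordinate ring of `SL₂` is spanned as a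
ℂ-vector space by products `f·g` with `f ∈ ℂ[a₁,a₂]` and `g ∈ ℂ[b₁,b₂]`. -/
theorem sl2_span_ker_mul_ker :
    Submodule.span ℂ
      { p : SL2Coord |
        ∃ f ∈ Algebra.adjoin ℂ ({SL2Coord.mk (X 0), SL2Coord.mk (X 1)} : Set SL2Coord),
          ∃ g ∈ Algebra.adjoin ℂ ({SL2Coord.mk (X 2), SL2Coord.mk (X 3)} : Set SL2Coord),
            p = f * g }
      = ⊤ := by
  rw [eq_top_iff]
  rintro x -
  obtain ⟨p, rfl⟩ := Ideal.Quotient.mk_surjective x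
  induction p using MvPolynomial.induction_on with
  | C c =>
    refine Submodule.subset_span ⟨_, Subalgebra.algebraMap_mem _ c, 1, one_mem _, ?_⟩
    rw [mul_one]
    rfl
  | add p q hp hq =>
    rw [map_add]
    exact add_mem hp hq
  | mul_X p i hp =>
    rw [map_mul]
    generalize SL2Coord.mk p = y at hp ⊢
    induction hp using Submodule.span_induction with
    | mem _ h =>
      obtain ⟨f, hf, g, hg, rfl⟩ := h
      apply Submodule.subset_span
      fin_cases i
      · exact ⟨_, mul_mem hf (Algebra.subset_adjoin (Or.inl rfl)), g, hg, mul_right_comm _ _ _⟩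
      · exact ⟨_, mul_mem hf (Algebra.subset_adjoin (Or.inr rfl)), g, hg, mul_right_comm _ _ _⟩
      · exact ⟨f, hf, _, mul_mem hg (Algebra.subset_adjoin (Or.inl rfl)), mul_assoc _ _ _⟩
      · exact ⟨f, hf, _, mul_mem hg (Algebra.subset_adjoin (Or.inr rfl)), mul_assoc _ _ _⟩
    | zero =>
      rw [zero_mul]
      exact zero_mem _
    | add _ _ _ _ hx hy =>
      rw [add_mul]
      exact add_mem hx hy
    | smul c _ _ hx =>
      rw [smul_mul_assoc]
      exact Submodule.smul_mem _ c hx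
end

section
/- Let p, q, r ∈ ℂ[t] be polynomials in one variable satisfying p + q + p·q·r = 1, and suppose that not all three of p, q, r are constant. Then p = 0, or q = 0, or r = 0, or p·r = −1, or q·r = −1. (Equivalently: every polynomial curve in the surface S = {x + y + xyz = 1} ⊂ ℂ³ is contained in one of the five lines L₁ = {x = 0}, L₂ = {yz + 1 = 0}, L₃ = {y = 0}, L₄ = {xz + 1 = 0}, L₅ = {z = 0}.) -/
open Polynomial

/-- If `p` is constant but `q` is not, then `p + q + p * q * r = 1` forces
`p * r = -1`. -/
theorem mul_eq_neg_one_of_natDegree_eq_zero {p q r : Polynomial ℂ}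
    (h : p + q + p * q * r = 1) (hp : p.natDegree = 0)
    (hq : q.natDegree ≠ 0) : p * r = -1 := by
  by_contra hne
  have hu : 1 + p * r ≠ 0 := fun h0 => hne (by linear_combination h0)
  have hq0 : q ≠ 0 := by rintro rfl; simp at hq
  have hmul : q * (1 + p * r) = 1 - p := by linear_combination h
  have hdeg := congrArg natDegree hmul
  rw [natDegree_mul hq0 hu] at hdeg
  have hle := natDegree_sub_le (1 : Polynomial ℂ) p
  rw [natDegree_one, hp, max_self] at hle
  omega

/-- Every polynomial curve in the surface `S = {x + y + xyz = 1} ⊂ ℂ³` is contained in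
one of the five lines `x = 0`, `yz + 1 = 0`, `y = 0`, `xz + 1 = 0`, `z = 0`: if
`p + q + p·q·r = 1` for one-variable polynomials `p, q, r` which are not all constant,
then `p = 0`, `q = 0`, `r = 0`, `p·r = −1`, or `q·r = −1`. -/
theorem polynomial_curves_in_S (p q r : Polynomial ℂ)
    (h : p + q + p * q * r = 1)
    (hnc : ¬ ∃ cp cq cr : ℂ, p = C cp ∧ q = C cq ∧ r = C cr) :
    p = 0 ∨ q = 0 ∨ r = 0 ∨ p * r = -1 ∨ q * r = -1 := by
  by_cases hp0 : p = 0
  · exact Or.inl hp0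
  by_cases hq0 : q = 0
  · exact Or.inr (Or.inl hq0)
  by_cases hr0 : r = 0
  · exact Or.inr (Or.inr (Or.inl hr0))
  have hdeg : p.natDegree + q.natDegree + r.natDegree ≤ max p.natDegree q.natDegree := by
    rw [← natDegree_mul hp0 hq0, ← natDegree_mul (mul_ne_zero hp0 hq0) hr0,
      show p * q * r = 1 - (p + q) by linear_combination h]
    refine (natDegree_sub_le _ _).trans ?_
    rw [natDegree_one, Nat.zero_max]
    exact natDegree_add_le p q
  have hr : r.natDegree = 0 := by omega
  by_cases hq : q.natDegree = 0
  · by_cases hp : p.natDegree = 0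
    · exact absurd ⟨_, _, _, eq_C_of_natDegree_eq_zero hp, eq_C_of_natDegree_eq_zero hq,
        eq_C_of_natDegree_eq_zero hr⟩ hnc
    · exact Or.inr (Or.inr (Or.inr (Or.inr (mul_eq_neg_one_of_natDegree_eq_zero
        (by linear_combination h) hq hp))))
  · exact Or.inr (Or.inr (Or.inr (Or.inl (mul_eq_neg_one_of_natDegree_eq_zero
      h (by omega) hq))))
end

section
/- Let p, q ∈ ℂ[t] be nonconstant polynomials in one variable such that q divides 1 − p and p divides 1 − q. Then p + q = 1, i.e. p(t) = 1 − q(t). -/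
open Polynomial

/-- If `p, q ∈ ℂ[t]` are nonconstant polynomials such that `q ∣ 1 − p` and
`p ∣ 1 − q`, then `p + q = 1`. -/
theorem nonconstant_mutual_divisibility (p q : Polynomial ℂ)
    (hp : 1 ≤ p.natDegree) (hq : 1 ≤ q.natDegree)
    (hdvd₁ : q ∣ (1 - p)) (hdvd₂ : p ∣ (1 - q)) :
    p + q = 1 := by
  have hcop : IsCoprime p q := by
    obtain ⟨c, hc⟩ := hdvd₁
    exact ⟨1, c, by linear_combination -hc⟩
  have hdvd : p * q ∣ 1 - (p + q) := by
    refine hcop.mul_dvd ?_ ?_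
    · simpa only [sub_sub, add_comm q p] using dvd_sub_self_right.mpr hdvd₂
    · simpa only [sub_sub] using dvd_sub_self_right.mpr hdvd₁
  have hp0 : p ≠ 0 := ne_zero_of_natDegree_gt hp
  have hq0 : q ≠ 0 := ne_zero_of_natDegree_gt hq
  have hdeg : (1 - (p + q)).natDegree < (p * q).natDegree := by
    have h₁ := natDegree_sub_le 1 (p + q)
    have h₂ := natDegree_add_le p q
    rw [natDegree_one] at h₁
    rw [natDegree_mul hp0 hq0]
    omega
  exact (sub_eq_zero.mp (eq_zero_of_dvd_of_natDegree_lt hdvd hdeg)).symm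
end

section
/- The ideal generated by X + Y + X·Y·Z − 1 in the polynomial ring ℂ[X,Y,Z] is a prime ideal, and the quotient ring ℂ[X,Y,Z]/(X + Y + X·Y·Z − 1) (the coordinate ring of the surface S) is a unique factorization domain. -/
open MvPolynomial

section Nagata

variable {R : Type*} [CommRing R] [IsDomain R] {T : Set R}

theorem isPrimal_of_mem_closure_of_prime (hT : ∀ p ∈ T, Prime p) {s : R}
    (hs : s ∈ Submonoid.closure T) : IsPrimal s :=
  (Submonoid.closure_le (S := Submonoid.isPrimal R)).2 (fun p hp ↦ (hT p hp).isPrimal) hs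

theorem Irreducible.prime_of_dvd_mem_closure_of_prime (hT : ∀ p ∈ T, Prime p) {f s : R}
    (hf : Irreducible f) (hs : s ∈ Submonoid.closure T) (hfs : f ∣ s) : Prime f := by
  induction hs using Submonoid.closure_induction_left with
  | one => exact (hf.not_isUnit (isUnit_of_dvd_one hfs)).elim
  | mul_left p hp t _ ih =>
    obtain ⟨g, hg⟩ := hfs
    obtain h | ⟨c, rfl⟩ := (hT p hp).dvd_or_dvd ⟨t, hg.symm⟩
    · exact ((hT p hp).irreducible.associated_of_dvd hf h).prime (hT p hp)
    · refine ih ⟨c, mul_left_cancel₀ (hT p hp).ne_zero ?_⟩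
      rw [hg]
      ring

theorem Irreducible.prime_of_isLocalization_closure_of_prime (hT : ∀ p ∈ T, Prime p)
    (K : Type*) [CommRing K] [IsDomain K] [Algebra R K]
    [IsLocalization (Submonoid.closure T) K] [UniqueFactorizationMonoid K] {f : R}
    (hf : Irreducible f) : Prime f := by
  by_cases hfS : ∃ s ∈ Submonoid.closure T, f ∣ s
  · obtain ⟨s, hs, hfs⟩ := hfS
    exact hf.prime_of_dvd_mem_closure_of_prime hT hs hfs
  have hS : Submonoid.closure T ≤ nonZeroDivisors R :=
    Submonoid.closure_le.2 fun p hp ↦ mem_nonZeroDivisors_of_ne_zero (hT p hp).ne_zero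
  have inj : Function.Injective (algebraMap R K) := IsLocalization.injective K hS
  have unit_of_dvd {u s : R} (hs : s ∈ Submonoid.closure T) (h : u ∣ s) :
      IsUnit (algebraMap R K u) :=
    isUnit_of_dvd_unit (map_dvd _ h) (IsLocalization.map_units K (⟨s, hs⟩ : Submonoid.closure T))
  have hfK : Irreducible (algebraMap R K f) := by
    refine ⟨fun h ↦ ?_, fun x y hxy ↦ ?_⟩
    · obtain ⟨k, hk⟩ := h.exists_right_inv
      obtain ⟨⟨a, s⟩, ha⟩ := IsLocalization.surj (Submonoid.closure T) k
      refine hfS ⟨s, s.2, a, inj ?_⟩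
      rw [map_mul, ← ha, ← mul_assoc, hk, one_mul]
    · obtain ⟨⟨a, s⟩, ha⟩ := IsLocalization.surj (Submonoid.closure T) x
      obtain ⟨⟨b, t⟩, hb⟩ := IsLocalization.surj (Submonoid.closure T) y
      have hst : ((s * t : Submonoid.closure T) : R) * f = a * b := inj <| by
        simp only [Submonoid.coe_mul, map_mul, ← ha, ← hb, hxy]
        ring
      have hst0 := nonZeroDivisors.ne_zero (hS (s * t).2)
      obtain ⟨u, v, ⟨a', rfl⟩, ⟨b', rfl⟩, huv⟩ :=
        isPrimal_of_mem_closure_of_prime hT (s * t).2 ⟨f, hst.symm⟩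
      have hf' : f = a' * b' := mul_left_cancel₀ hst0 <| by
        rw [hst, huv]
        ring
      rcases hf.isUnit_or_isUnit hf' with h | h
      · left
        refine isUnit_of_mul_isUnit_left (y := algebraMap R K s) ?_
        rw [ha, map_mul]
        exact (unit_of_dvd (s * t).2 ⟨v, huv⟩).mul (h.map _)
      · right
        refine isUnit_of_mul_isUnit_left (y := algebraMap R K t) ?_
        rw [hb, map_mul]
        exact (unit_of_dvd (s * t).2 ⟨u, huv.trans (mul_comm _ _)⟩).mul (h.map _)
  have dvd_of_map {a : R} (h : algebraMap R K f ∣ algebraMap R K a) : f ∣ a := by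
    obtain ⟨k, hk⟩ := h
    obtain ⟨⟨c, s⟩, hc⟩ := IsLocalization.surj (Submonoid.closure T) k
    have hs : f * c = s * a := inj <| by
      rw [map_mul, map_mul, ← hc, hk]
      ring
    obtain ⟨u, v, ⟨f', hf'⟩, ⟨c', rfl⟩, huv⟩ :=
      isPrimal_of_mem_closure_of_prime hT s.2 ⟨a, hs⟩
    have hs0 := nonZeroDivisors.ne_zero (hS s.2)
    have hf'u : IsUnit u := by
      refine (hf.isUnit_or_isUnit hf').resolve_right fun h ↦ hfS ⟨s, s.2, ?_⟩
      rw [hf', h.mul_right_dvd, huv]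
      exact dvd_mul_right _ _
    rw [huv, mul_assoc, mul_left_comm, mul_left_comm u] at hs
    have hv0 : v ≠ 0 := right_ne_zero_of_mul (huv ▸ hs0)
    have := mul_left_cancel₀ hv0 hs
    rw [← hf'u.dvd_mul_left, ← this]
    exact dvd_mul_right _ _
  refine ⟨hf.ne_zero, hf.not_isUnit, fun a b hab ↦ ?_⟩
  refine (hfK.prime.dvd_or_dvd ?_).imp dvd_of_map dvd_of_map
  rw [← map_mul]
  exact map_dvd _ hab

/-- Nagata's criterion for factoriality. -/
theorem UniqueFactorizationMonoid.of_isLocalization_closure_of_prime [WfDvdMonoid R]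
    (hT : ∀ p ∈ T, Prime p) (K : Type*) [CommRing K] [IsDomain K] [Algebra R K]
    [IsLocalization (Submonoid.closure T) K] [UniqueFactorizationMonoid K] :
    UniqueFactorizationMonoid R where
  irreducible_iff_prime :=
    ⟨fun hf ↦ hf.prime_of_isLocalization_closure_of_prime hT K, Prime.irreducible⟩

end Nagata

/-- An element is prime if the quotient by it embeds in a domain, the embedding being witnessed by
a map `σ` that inverts `π` modulo the element. -/
theorem Prime.of_section {R B : Type*} [CommRing R] [CommRing B] [IsDomain B]
    (π : R →+* B) (σ : B →+* R) {x : R} (hx : x ≠ 0) (hπ : π x = 0)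
    (h : (Ideal.Quotient.mk (Ideal.span {x})).comp (σ.comp π) = Ideal.Quotient.mk _) :
    Prime x := by
  have key (r : R) (hr : π r = 0) : x ∣ r := by
    have := DFunLike.congr_fun h r
    rw [RingHom.comp_apply, RingHom.comp_apply, hr, map_zero, map_zero] at this
    exact Ideal.mem_span_singleton.1 (Ideal.Quotient.eq_zero_iff_mem.1 this.symm)
  refine ⟨hx, fun hu ↦ not_isUnit_zero (hπ ▸ hu.map π), fun a b hab ↦ ?_⟩
  obtain ⟨c, hc⟩ := hab
  have : π a * π b = 0 := by rw [← map_mul, hc, map_mul, hπ, zero_mul]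
  exact (mul_eq_zero.1 this).imp (key a) (key b)

namespace SurfaceS

/-- The equation of the surface `S`. -/
noncomputable abbrev equation : MvPolynomial (Fin 3) ℂ := X 0 + X 1 + X 0 * X 1 * X 2 - 1

/-- The coordinate ring of the surface `S`. -/
abbrev CoordinateRing : Type := MvPolynomial (Fin 3) ℂ ⧸ Ideal.span {equation}

/-- The class of a polynomial in the coordinate ring of `S`. -/
noncomputable abbrev mk : MvPolynomial (Fin 3) ℂ →ₐ[ℂ] CoordinateRing := Ideal.Quotient.mkₐ ℂ _

theorem mk_equation :
    mk (X 0) + mk (X 1) + mk (X 0) * mk (X 1) * mk (X 2) = 1 := by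
  rw [← sub_eq_zero, ← map_one mk]
  simp only [← map_mul, ← map_add, ← map_sub]
  exact Ideal.Quotient.eq_zero_iff_mem.2 (Ideal.mem_span_singleton_self _)

/-- The map of coordinate rings induced by the projection of `S` to the `(x, y)`-plane. -/
noncomputable def ofPlane : MvPolynomial (Fin 2) ℂ →ₐ[ℂ] CoordinateRing :=
  aeval ![mk (X 0), mk (X 1)]

/-- The multiplicative set of monomials in the coordinate ring of the plane. -/
noncomputable abbrev planeMonomials : Submonoid (MvPolynomial (Fin 2) ℂ) :=
  Submonoid.closure {X 0, X 1}

/-- The coordinate ring of the torus `{xy ≠ 0}`. -/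
abbrev TorusRing : Type := Localization planeMonomials

theorem planeMonomials_le : planeMonomials ≤ nonZeroDivisors (MvPolynomial (Fin 2) ℂ) := by
  rw [Submonoid.closure_le]
  rintro _ (rfl | rfl) <;> exact mem_nonZeroDivisors_of_ne_zero (X_ne_zero _)

instance : IsDomain TorusRing := IsLocalization.isDomain_localization planeMonomials_le

theorem isUnit_torus_X (i : Fin 2) :
    IsUnit (algebraMap (MvPolynomial (Fin 2) ℂ) TorusRing (X i)) :=
  IsLocalization.map_units TorusRing
    (⟨X i, Submonoid.subset_closure (by fin_cases i <;> simp)⟩ : planeMonomials)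

theorem exists_torus_z : ∃ z : TorusRing,
    algebraMap (MvPolynomial (Fin 2) ℂ) TorusRing (X 0) +
      algebraMap (MvPolynomial (Fin 2) ℂ) TorusRing (X 1) +
      algebraMap (MvPolynomial (Fin 2) ℂ) TorusRing (X 0) *
        algebraMap (MvPolynomial (Fin 2) ℂ) TorusRing (X 1) * z = 1 := by
  obtain ⟨u, hu⟩ := ((isUnit_torus_X 0).mul (isUnit_torus_X 1)).exists_right_inv
  refine ⟨u * (1 - algebraMap (MvPolynomial (Fin 2) ℂ) TorusRing (X 0) -
    algebraMap (MvPolynomial (Fin 2) ℂ) TorusRing (X 1)), ?_⟩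
  rw [← mul_assoc, hu]
  ring

/-- Restriction of functions on `S` to the open subset `{xy ≠ 0}`, which is a torus. -/
noncomputable def toTorus : CoordinateRing →ₐ[ℂ] TorusRing :=
  Ideal.Quotient.liftₐ _
    (aeval ![algebraMap (MvPolynomial (Fin 2) ℂ) TorusRing (X 0),
      algebraMap (MvPolynomial (Fin 2) ℂ) TorusRing (X 1), exists_torus_z.choose]) <| by
    intro a ha
    rw [← RingHom.mem_ker]
    refine (Ideal.span_singleton_le_iff_mem _).2 ?_ ha
    rw [RingHom.mem_ker]
    simpa [sub_eq_zero] using exists_torus_z.choose_spec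

theorem toTorus_ofPlane (g : MvPolynomial (Fin 2) ℂ) :
    toTorus (ofPlane g) = algebraMap _ TorusRing g := by
  have : toTorus.comp ofPlane = IsScalarTower.toAlgHom ℂ (MvPolynomial (Fin 2) ℂ) TorusRing := by
    refine MvPolynomial.algHom_ext fun i ↦ ?_
    rw [AlgHom.comp_apply, ofPlane, aeval_X]
    fin_cases i
    · exact aeval_X _ 0
    · exact aeval_X _ 1
  exact DFunLike.congr_fun this g

theorem ofPlane_injective : Function.Injective ofPlane := by
  refine Function.Injective.of_comp (f := toTorus) ?_
  convert IsLocalization.injective TorusRing planeMonomials_le using 1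
  exact funext toTorus_ofPlane

theorem exists_monomial_mul_eq (r : CoordinateRing) :
    ∃ s ∈ planeMonomials, ∃ g, ofPlane s * r = ofPlane g := by
  obtain ⟨G, rfl⟩ := Ideal.Quotient.mkₐ_surjective ℂ _ r
  induction G using MvPolynomial.induction_on with
  | C a =>
    refine ⟨1, one_mem _, C a, ?_⟩
    rw [map_one, one_mul, ← algebraMap_eq, ← algebraMap_eq, AlgHom.commutes, AlgHom.commutes]
  | add p q hp hq =>
    obtain ⟨s, hs, g, hg⟩ := hp
    obtain ⟨t, ht, h, hh⟩ := hq
    refine ⟨s * t, mul_mem hs ht, t * g + s * h, ?_⟩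
    simp only [map_mul, map_add, ← hg, ← hh]
    ring
  | mul_X p i hp =>
    obtain ⟨s, hs, g, hg⟩ := hp
    have h0 : ofPlane (X 0) = mk (X 0) := by simp [ofPlane]
    have h1 : ofPlane (X 1) = mk (X 1) := by simp [ofPlane]
    fin_cases i
    · refine ⟨s, hs, g * X 0, ?_⟩
      rw [map_mul, map_mul, ← hg, ← mul_assoc, h0]
      rfl
    · refine ⟨s, hs, g * X 1, ?_⟩
      rw [map_mul, map_mul, ← hg, ← mul_assoc, h1]
      rfl
    · refine ⟨s * (X 0 * X 1), mul_mem hs (mul_mem (Submonoid.subset_closure (by simp))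
        (Submonoid.subset_closure (by simp))), g * (1 - X 0 - X 1), ?_⟩
      simp only [map_mul, map_sub, map_one, ← hg, h0, h1]
      change ofPlane s * (mk (X 0) * mk (X 1)) * (mk p * mk (X 2)) = _
      linear_combination ofPlane s * mk p * mk_equation

theorem eq_zero_of_mk_X_mul_eq_zero {i : Fin 3} (r : CoordinateRing) (h : mk (X i) * r = 0) :
    r = 0 := by
  obtain ⟨G, rfl⟩ := Ideal.Quotient.mkₐ_surjective ℂ _ r
  rw [← map_mul] at h
  obtain ⟨H, hH⟩ := Ideal.mem_span_singleton.1 (Ideal.Quotient.eq_zero_iff_mem.1 h)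
  have hX : Prime (X i : MvPolynomial (Fin 3) ℂ) := X_prime
  refine Ideal.Quotient.eq_zero_iff_mem.2 (Ideal.mem_span_singleton.2 ?_)
  rcases hX.dvd_or_dvd ⟨G, hH.symm⟩ with ⟨c, hc⟩ | ⟨c, rfl⟩
  · have := congr_arg (eval 0) hc
    simp at this
  · exact ⟨c, mul_left_cancel₀ hX.ne_zero (by rw [hH]; ring)⟩

theorem eq_zero_of_ofPlane_mul_eq_zero {s : MvPolynomial (Fin 2) ℂ} (hs : s ∈ planeMonomials)
    {r : CoordinateRing} (h : ofPlane s * r = 0) : r = 0 := by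
  induction hs using Submonoid.closure_induction_left with
  | one => simpa using h
  | mul_left p hp t _ ih =>
    rw [map_mul, mul_assoc] at h
    refine ih ?_
    rcases hp with rfl | rfl
    · exact eq_zero_of_mk_X_mul_eq_zero (i := 0) _ (by simpa [ofPlane] using h)
    · exact eq_zero_of_mk_X_mul_eq_zero (i := 1) _ (by simpa [ofPlane] using h)

theorem toTorus_injective : Function.Injective toTorus := by
  rw [injective_iff_map_eq_zero]
  intro r hr
  obtain ⟨s, hs, g, hg⟩ := exists_monomial_mul_eq r
  refine eq_zero_of_ofPlane_mul_eq_zero hs ?_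
  have := congr_arg toTorus hg
  rw [map_mul, hr, mul_zero, toTorus_ofPlane] at this
  rw [hg, (injective_iff_map_eq_zero _).1
    (IsLocalization.injective TorusRing planeMonomials_le) g this.symm, map_zero]

instance : IsDomain CoordinateRing := toTorus_injective.isDomain toTorus.toRingHom

theorem prime_mk_X {i j : Fin 3} (hij : i = 0 ∧ j = 1 ∨ i = 1 ∧ j = 0) :
    Prime (mk (X i)) := by
  let v : Fin 3 → Polynomial ℂ := fun k ↦ if k = i then 0 else if k = j then 1 else Polynomial.X
  let π : CoordinateRing →ₐ[ℂ] Polynomial ℂ := Ideal.Quotient.liftₐ _ (aeval v) <| by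
    intro a ha
    rw [← RingHom.mem_ker]
    refine (Ideal.span_singleton_le_iff_mem _).2 ?_ ha
    rw [RingHom.mem_ker]
    rcases hij with ⟨rfl, rfl⟩ | ⟨rfl, rfl⟩ <;> simp [v]
  let σ : Polynomial ℂ →ₐ[ℂ] CoordinateRing := Polynomial.aeval (mk (X 2))
  have hπ (k : Fin 3) : π (mk (X k)) = v k := aeval_X v k
  refine Prime.of_section π.toRingHom σ.toRingHom (fun h ↦ ?_) ((hπ i).trans (by simp [v])) ?_
  · refine one_ne_zero (eq_zero_of_mk_X_mul_eq_zero (i := i) 1 ?_)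
    rw [h, zero_mul]
  · let q : CoordinateRing →ₐ[ℂ] CoordinateRing ⧸ Ideal.span {mk (X i)} := Ideal.Quotient.mkₐ ℂ _
    suffices h : q.comp (σ.comp π) = q from congr_arg AlgHom.toRingHom h
    have hi : q (mk (X i)) = 0 :=
      Ideal.Quotient.eq_zero_iff_mem.2 (Ideal.mem_span_singleton_self _)
    have hj : q (mk (X j)) = 1 := by
      have := congr_arg q mk_equation
      rcases hij with ⟨rfl, rfl⟩ | ⟨rfl, rfl⟩ <;>
        · rw [map_add, map_add, map_mul, map_mul, hi, map_one] at this
          linear_combination this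
    refine Ideal.Quotient.algHom_ext _ (MvPolynomial.algHom_ext fun k ↦ ?_)
    change q (σ (π (mk (X k)))) = q (mk (X k))
    rw [hπ]
    by_cases hki : k = i
    · subst hki
      rw [hi, ← map_zero q, ← map_zero σ]
      simp [v]
    by_cases hkj : k = j
    · subst hkj
      rw [hj, ← map_one q, ← map_one σ]
      simp [v, hki]
    obtain rfl : k = 2 := by grind
    simp [v, hki, hkj, σ]

noncomputable instance : Algebra CoordinateRing TorusRing := toTorus.toRingHom.toAlgebra

instance : IsLocalization (Submonoid.closure {mk (X 0), mk (X 1)}) TorusRing := by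
  have hmap : Submonoid.closure {mk (X 0), mk (X 1)} = planeMonomials.map ofPlane := by
    rw [MonoidHom.map_mclosure, Set.image_pair]
    simp [ofPlane]
  rw [hmap, isLocalization_iff]
  refine ⟨?_, fun z ↦ ?_, fun {x y} h ↦ ⟨1, congr_arg _ (toTorus_injective h)⟩⟩
  · rintro ⟨_, s, hs, rfl⟩
    change IsUnit (toTorus (ofPlane s))
    rw [toTorus_ofPlane]
    exact IsLocalization.map_units TorusRing (⟨s, hs⟩ : planeMonomials)
  · obtain ⟨⟨g, s⟩, hg⟩ := IsLocalization.surj planeMonomials z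
    refine ⟨⟨ofPlane g, ⟨ofPlane s, s, s.2, rfl⟩⟩, ?_⟩
    change z * toTorus (ofPlane s) = toTorus (ofPlane g)
    rw [toTorus_ofPlane, toTorus_ofPlane, hg]

instance : UniqueFactorizationMonoid CoordinateRing :=
  .of_isLocalization_closure_of_prime (T := {mk (X 0), mk (X 1)})
    (by
      rintro _ (rfl | rfl)
      exacts [prime_mk_X (.inl ⟨rfl, rfl⟩), prime_mk_X (.inr ⟨rfl, rfl⟩)])
    TorusRing

end SurfaceS

/-- The ideal `(X + Y + XYZ − 1)` in `ℂ[X,Y,Z]` is prime, and the coordinate ring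
`ℂ[X,Y,Z]/(X + Y + XYZ − 1)` of the surface `S` is a unique factorization domain. -/
theorem surface_S_factorial :
    ∃ hp : (Ideal.span
        {(X 0 + X 1 + X 0 * X 1 * X 2 - 1 : MvPolynomial (Fin 3) ℂ)}).IsPrime,
      haveI := hp
      haveI : IsDomain (MvPolynomial (Fin 3) ℂ ⧸
          Ideal.span {(X 0 + X 1 + X 0 * X 1 * X 2 - 1 : MvPolynomial (Fin 3) ℂ)}) :=
        Ideal.Quotient.isDomain _
      UniqueFactorizationMonoid (MvPolynomial (Fin 3) ℂ ⧸
        Ideal.span {(X 0 + X 1 + X 0 * X 1 * X 2 - 1 : MvPolynomial (Fin 3) ℂ)}) :=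
  ⟨(Ideal.Quotient.isDomain_iff_prime _).1 (inferInstanceAs (IsDomain SurfaceS.CoordinateRing)),
    inferInstanceAs (UniqueFactorizationMonoid SurfaceS.CoordinateRing)⟩
end
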